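/- arXiv:1102.2593 — 5 statements merged into one kernel-verified Lean document; each statement's English description precedes it below -/
import Mathlib

section
/- Let q be a prime power, let n, k, δ be integers with 1 < k ≤ n−k and 1 ≤ δ ≤ k, and let 𝒞 be a [k×(n−k), (n−k)(k−δ+1), δ]_q MRD code. Then the lifted code C^MRD = {row space of [I_k | A] : A ∈ 𝒞} consists of exactly q^{(n−k)(k−δ+1)} distinct k-dimensional subspaces of 𝔽_q^n, and any two distinct codewords X, Y ∈ C^MRD satisfy d_S(X,Y) ≥ 2δ; that is, C^MRD is an (n, q^{(n−k)(k−δ+1)}, 2δ, k)_q constant dimension code. -/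
open Module Polynomial Matrix

variable (F : Type) [Field F] [Fintype F]

/-- `C` is a `[k × (n-k), (n-k)(k-δ+1), δ]_q` MRD (maximum rank distance) code:
an `F`-linear subspace of `k × (n-k)` matrices of dimension `(n-k)(k-δ+1)` in which
every nonzero matrix has rank at least `δ`. -/
def IsMRD (n k δ : ℕ) (C : Submodule F (Matrix (Fin k) (Fin (n - k)) F)) : Prop :=
  Module.finrank F C = (n - k) * (k - δ + 1) ∧
    ∀ A : Matrix (Fin k) (Fin (n - k)) F, A ∈ C → A ≠ 0 → δ ≤ A.rank

/-- The matrix `[I_k | A]`. -/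
def liftMatrix (n k : ℕ) (A : Matrix (Fin k) (Fin (n - k)) F) : Matrix (Fin k) (Fin n) F :=
  Matrix.of fun i j =>
    if h : (j : ℕ) < k then (if (i : ℕ) = (j : ℕ) then 1 else 0)
    else A i ⟨(j : ℕ) - k, by have := j.isLt; omega⟩

/-- The lifting of the matrix `A`: the row space of `[I_k | A]`, a subspace of `F^n`. -/
def liftSubspace (n k : ℕ) (A : Matrix (Fin k) (Fin (n - k)) F) : Submodule F (Fin n → F) :=
  Submodule.span F (Set.range fun i => liftMatrix F n k A i)

/-- The lifted code of a rank-metric code `C`: the set of liftings of all codewords of `C`. -/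
def liftedCode (n k : ℕ) (C : Submodule F (Matrix (Fin k) (Fin (n - k)) F)) :
    Set (Submodule F (Fin n → F)) :=
  {X | ∃ A ∈ C, X = liftSubspace F n k A}

/-- The subspace distance `d_S(X,Y) = dim X + dim Y - 2 dim (X ⊓ Y)`. -/
noncomputable def subDist {n : ℕ} (X Y : Submodule F (Fin n → F)) : ℕ :=
  finrank F X + finrank F Y - 2 * finrank F (X ⊓ Y : Submodule F (Fin n → F))

/-- `L^{(n,k)}`: vectors of `F^n` whose first `k` coordinates are not all zero. -/
def Lset (n k : ℕ) : Set (Fin n → F) := {v | ∃ i : Fin n, (i : ℕ) < k ∧ v i ≠ 0}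

/-- `V^n`: one-dimensional subspaces of `F^n` spanned by vectors of `L^{(n,k)}`. -/
def Vset (n k : ℕ) : Set (Submodule F (Fin n → F)) :=
  {X | ∃ v ∈ Lset F n k, X = Submodule.span F {v}}

/-- Projection of a vector of `F^n` onto its first `k` coordinates. -/
def projK (n k : ℕ) (v : Fin n → F) : Fin k → F :=
  fun i => if h : (i : ℕ) < n then v ⟨(i : ℕ), h⟩ else 0

/-- `V_A^{(n,k)}`: one-dimensional subspaces of `F^n` spanned by vectors whose projection
onto the first `k` coordinates is a nonzero vector spanning `A`. -/
def VA (n k : ℕ) (A : Submodule F (Fin k → F)) : Set (Submodule F (Fin n → F)) :=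
  {X | ∃ v : Fin n → F, projK F n k v ≠ 0 ∧ Submodule.span F {projK F n k v} = A ∧
    X = Submodule.span F {v}}

/-- `A_q(n,d,k)`: the maximum size of an `(n, M, d, k)_q` constant dimension code, i.e. of a
set of `k`-dimensional subspaces of `F^n` whose pairwise subspace distances are at least `d`. -/
noncomputable def Aq (n d k : ℕ) : ℕ :=
  sSup {M | ∃ S : Set (Submodule F (Fin n → F)), S.Finite ∧ S.ncard = M ∧
    (∀ X ∈ S, finrank F X = k) ∧ ∀ X ∈ S, ∀ Y ∈ S, X ≠ Y → d ≤ subDist F X Y}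

/-- The Gaussian coefficient `[n, k]_q`: the number of `k`-dimensional subspaces of `F^n`. -/
noncomputable def gaussNat (n k : ℕ) : ℕ :=
  Nat.card {X : Submodule F (Fin n → F) // finrank F X = k}

section Lifting

variable {K : Type} [Field K] {n k : ℕ}

theorem vecMul_liftMatrix_of_lt (hkn : k ≤ n) (A : Matrix (Fin k) (Fin (n - k)) K)
    (x : Fin k → K) (i : Fin k) :
    (x ᵥ* liftMatrix K n k A) (Fin.castLE hkn i) = x i := by
  simp [Matrix.vecMul, dotProduct, liftMatrix, Fin.val_inj]

theorem vecMul_liftMatrix_of_ge (A : Matrix (Fin k) (Fin (n - k)) K)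
    (x : Fin k → K) (j : Fin n) (hj : ¬ (j : ℕ) < k) :
    (x ᵥ* liftMatrix K n k A) j = (x ᵥ* A) ⟨(j : ℕ) - k, by omega⟩ := by
  simp [Matrix.vecMul, dotProduct, liftMatrix, hj]

theorem vecMul_liftMatrix_eq_iff (hkn : k ≤ n) (A B : Matrix (Fin k) (Fin (n - k)) K)
    (x y : Fin k → K) :
    x ᵥ* liftMatrix K n k A = y ᵥ* liftMatrix K n k B ↔ x = y ∧ x ᵥ* A = y ᵥ* B := by
  constructor
  · intro h
    constructor
    · ext i
      simpa [vecMul_liftMatrix_of_lt] using congrFun h (Fin.castLE hkn i)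
    · ext j
      have hj := congrFun h ⟨k + j, by omega⟩
      rw [vecMul_liftMatrix_of_ge _ _ _ (by simp), vecMul_liftMatrix_of_ge _ _ _ (by simp)] at hj
      simpa using hj
  · rintro ⟨rfl, h⟩
    ext j
    by_cases hj : (j : ℕ) < k
    · exact (vecMul_liftMatrix_of_lt hkn A x ⟨j, hj⟩).trans
        (vecMul_liftMatrix_of_lt hkn B x ⟨j, hj⟩).symm
    · rw [vecMul_liftMatrix_of_ge _ _ _ hj, vecMul_liftMatrix_of_ge _ _ _ hj, h]

theorem vecMulLinear_liftMatrix_injective (hkn : k ≤ n) (A : Matrix (Fin k) (Fin (n - k)) K) :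
    Function.Injective (liftMatrix K n k A).vecMulLinear := fun x y h =>
  ((vecMul_liftMatrix_eq_iff hkn A A x y).1 h).1

theorem liftSubspace_eq_range (A : Matrix (Fin k) (Fin (n - k)) K) :
    liftSubspace K n k A = LinearMap.range (liftMatrix K n k A).vecMulLinear :=
  (range_vecMulLinear (liftMatrix K n k A)).symm

theorem finrank_liftSubspace (hkn : k ≤ n) (A : Matrix (Fin k) (Fin (n - k)) K) :
    finrank K (liftSubspace K n k A) = k := by
  rw [liftSubspace_eq_range,
    LinearMap.finrank_range_of_inj (vecMulLinear_liftMatrix_injective hkn A), finrank_fin_fun]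

theorem liftSubspace_inf (hkn : k ≤ n) (A B : Matrix (Fin k) (Fin (n - k)) K) :
    liftSubspace K n k A ⊓ liftSubspace K n k B =
      (LinearMap.ker (A - B).vecMulLinear).map (liftMatrix K n k A).vecMulLinear := by
  ext v
  simp only [liftSubspace_eq_range, Submodule.mem_inf, LinearMap.mem_range, Submodule.mem_map,
    LinearMap.mem_ker, Matrix.vecMulLinear_apply, Matrix.vecMul_sub, sub_eq_zero]
  constructor
  · rintro ⟨⟨x, rfl⟩, y, hy⟩
    obtain ⟨rfl, h⟩ := (vecMul_liftMatrix_eq_iff hkn B A y x).1 hy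
    exact ⟨y, h.symm, rfl⟩
  · rintro ⟨x, hx, rfl⟩
    exact ⟨⟨x, rfl⟩, x, (vecMul_liftMatrix_eq_iff hkn B A x x).2 ⟨rfl, hx.symm⟩⟩

theorem rank_sub_add_finrank_liftSubspace_inf (hkn : k ≤ n)
    (A B : Matrix (Fin k) (Fin (n - k)) K) :
    (A - B).rank +
      finrank K (liftSubspace K n k A ⊓ liftSubspace K n k B : Submodule K (Fin n → K)) = k := by
  rw [liftSubspace_inf hkn,
    (Submodule.equivMapOfInjective _ (vecMulLinear_liftMatrix_injective hkn A) _).finrank_eq.symm,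
    Matrix.rank_eq_finrank_span_row, ← range_vecMulLinear,
    LinearMap.finrank_range_add_finrank_ker, finrank_fin_fun]

theorem subDist_liftSubspace (hkn : k ≤ n) (A B : Matrix (Fin k) (Fin (n - k)) K) :
    subDist K (liftSubspace K n k A) (liftSubspace K n k B) = 2 * (A - B).rank := by
  have h := rank_sub_add_finrank_liftSubspace_inf hkn A B
  rw [subDist, finrank_liftSubspace hkn, finrank_liftSubspace hkn]
  omega

theorem liftSubspace_injective (hkn : k ≤ n) :
    Function.Injective (liftSubspace K n k) := fun A B h => by
  refine Matrix.ext_of_single_vecMul fun i => ?_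
  have hmem : Pi.single i 1 ᵥ* liftMatrix K n k A ∈ liftSubspace K n k B := by
    rw [← h, liftSubspace_eq_range]
    exact ⟨Pi.single i 1, rfl⟩
  rw [liftSubspace_eq_range] at hmem
  obtain ⟨y, hy⟩ := hmem
  obtain ⟨rfl, hyA⟩ := (vecMul_liftMatrix_eq_iff hkn B A y _).1 hy
  exact hyA.symm

end Lifting

/-- The lifted code of a `[k × (n-k), (n-k)(k-δ+1), δ]_q` MRD code is an
`(n, q^{(n-k)(k-δ+1)}, 2δ, k)_q` constant dimension code. -/
theorem stmt0 (q n k δ : ℕ) (hq : Fintype.card F = q)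
    (hk : 1 < k) (hkn : k ≤ n - k) (hδ1 : 1 ≤ δ) (hδk : δ ≤ k)
    (C : Submodule F (Matrix (Fin k) (Fin (n - k)) F)) (hC : IsMRD F n k δ C) :
    (liftedCode F n k C).ncard = q ^ ((n - k) * (k - δ + 1)) ∧
    (∀ X ∈ liftedCode F n k C, finrank F X = k) ∧
    (∀ X ∈ liftedCode F n k C, ∀ Y ∈ liftedCode F n k C, X ≠ Y → 2 * δ ≤ subDist F X Y) := by
  have hn : k ≤ n := by omega
  refine ⟨?_, ?_, ?_⟩
  · have himage : liftedCode F n k C = liftSubspace F n k '' C := by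
      ext X
      simp [liftedCode, eq_comm]
    rw [himage, Set.ncard_image_of_injective _ (liftSubspace_injective hn), ← Nat.card_coe_set_eq,
      ← hC.1, ← hq, ← Nat.card_eq_fintype_card]
    exact Module.natCard_eq_pow_finrank (K := F) (V := C)
  · rintro _ ⟨A, -, rfl⟩
    exact finrank_liftSubspace hn A
  · rintro _ ⟨A, hA, rfl⟩ _ ⟨B, hB, rfl⟩ hne
    rw [subDist_liftSubspace hn]
    have hAB : A - B ≠ 0 := sub_ne_zero.2 fun h => hne (congrArg _ h)
    exact Nat.mul_le_mul_left 2 (hC.2 _ (C.sub_mem hA hB) hAB)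
end

section
/- Let q be a prime power, let n, k, δ be integers with 1 < k ≤ n−k and 1 ≤ δ ≤ k, let 𝒞 be a [k×(n−k), (n−k)(k−δ+1), δ]_q MRD code, and let C^MRD be its lifted code. Then each (k−δ+1)-dimensional subspace Y of 𝔽_q^n all of whose nonzero vectors belong to L^{(n,k)} is contained in exactly one codeword of C^MRD. -/
open Module Polynomial Matrix

variable (F : Type) [Field F] [Fintype F]

section

variable {K : Type} [Field K]

/-- Restriction of a vector of `K^n` to its first `k` coordinates. -/
def headMap {n k : ℕ} (h : k ≤ n) : (Fin n → K) →ₗ[K] (Fin k → K) :=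
  LinearMap.funLeft K K (Fin.castLE h)

/-- Restriction of a vector of `K^n` to its last `n - k` coordinates. -/
def tailMap (n k : ℕ) : (Fin n → K) →ₗ[K] (Fin (n - k) → K) :=
  LinearMap.funLeft K K fun j => ⟨k + j, by omega⟩

lemma headMap_vecMul_liftMatrix {n k : ℕ} (h : k ≤ n) (A : Matrix (Fin k) (Fin (n - k)) K)
    (c : Fin k → K) : headMap h (c ᵥ* liftMatrix K n k A) = c := by
  ext j
  simp [headMap, LinearMap.funLeft_apply, Matrix.vecMul, dotProduct, liftMatrix, Fin.val_inj]

lemma tailMap_vecMul_liftMatrix {n k : ℕ} (A : Matrix (Fin k) (Fin (n - k)) K)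
    (c : Fin k → K) : tailMap n k (c ᵥ* liftMatrix K n k A) = c ᵥ* A := by
  ext j
  simp [tailMap, LinearMap.funLeft_apply, Matrix.vecMul, dotProduct, liftMatrix]

lemma eq_of_headMap_eq_of_tailMap_eq {n k : ℕ} (h : k ≤ n) {v w : Fin n → K}
    (hhead : headMap h v = headMap h w) (htail : tailMap n k v = tailMap n k w) :
    v = w := by
  ext j
  by_cases hj : (j : ℕ) < k
  · exact congrFun hhead ⟨j, hj⟩
  · have hjk : (⟨k + (j - k), by omega⟩ : Fin n) = j := Fin.ext (by simp; omega)
    have := congrFun htail ⟨j - k, by omega⟩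
    simpa [tailMap, LinearMap.funLeft_apply, hjk] using this

lemma mem_liftSubspace_iff {n k : ℕ} (h : k ≤ n) (A : Matrix (Fin k) (Fin (n - k)) K)
    (v : Fin n → K) :
    v ∈ liftSubspace K n k A ↔ headMap h v ᵥ* A = tailMap n k v := by
  have hrange : liftSubspace K n k A = LinearMap.range (liftMatrix K n k A).vecMulLinear :=
    (range_vecMulLinear _).symm
  rw [hrange, LinearMap.mem_range]
  constructor
  · rintro ⟨c, rfl⟩
    rw [Matrix.vecMulLinear_apply, headMap_vecMul_liftMatrix, tailMap_vecMul_liftMatrix]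
  · intro hv
    refine ⟨headMap h v, eq_of_headMap_eq_of_tailMap_eq h ?_ ?_⟩
    · rw [Matrix.vecMulLinear_apply, headMap_vecMul_liftMatrix]
    · rw [Matrix.vecMulLinear_apply, tailMap_vecMul_liftMatrix, hv]

/-- A subspace that `A` annihilates on the left has dimension at most the corank of `A`. -/
lemma rank_add_finrank_le_of_vecMul_eq_zero {k m : ℕ} (A : Matrix (Fin k) (Fin m) K)
    (W : Submodule K (Fin k → K)) (hW : ∀ w ∈ W, w ᵥ* A = 0) : A.rank + finrank K W ≤ k := by
  have hker : W ≤ LinearMap.ker A.vecMulLinear := fun w hw => hW w hw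
  have hle := Submodule.finrank_mono hker
  have hrn := A.vecMulLinear.finrank_range_add_finrank_ker
  rw [range_vecMulLinear, ← Matrix.rank_eq_finrank_span_row, Module.finrank_fin_fun] at hrn
  omega

/-- The linear map sending a matrix `A` to `y ↦ f y ᵥ* A`. -/
def vecMulHom {k m : ℕ} {Y : Type*} [AddCommGroup Y] [Module K Y] (f : Y →ₗ[K] (Fin k → K)) :
    Matrix (Fin k) (Fin m) K →ₗ[K] (Y →ₗ[K] (Fin m → K)) where
  toFun A := A.vecMulLinear ∘ₗ f
  map_add' A B := by ext; simp
  map_smul' a A := by ext; simp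

/-- For `f` injective with domain of dimension `k - δ + 1`, every linear map on that domain is
`y ↦ f y ᵥ* A` for a unique codeword `A` of the MRD code. -/
lemma IsMRD.bijective_vecMulHom {n k δ : ℕ} (hδk : δ ≤ k)
    {C : Submodule K (Matrix (Fin k) (Fin (n - k)) K)} (hC : IsMRD K n k δ C)
    {Y : Type*} [AddCommGroup Y] [Module K Y] [FiniteDimensional K Y]
    (hY : finrank K Y = k - δ + 1) {f : Y →ₗ[K] (Fin k → K)} (hf : Function.Injective f) :
    Function.Bijective ((vecMulHom f).domRestrict C) := by
  have hinj : Function.Injective ((vecMulHom f).domRestrict C) := by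
    rw [injective_iff_map_eq_zero]
    rintro ⟨A, hA⟩ h0
    by_contra hne
    have hrank := hC.2 A hA (by simpa using hne)
    have hsum := rank_add_finrank_le_of_vecMul_eq_zero A (LinearMap.range f) (by
      rintro _ ⟨y, rfl⟩
      exact LinearMap.congr_fun h0 y)
    rw [LinearMap.finrank_range_of_inj hf, hY] at hsum
    omega
  refine ⟨hinj, (LinearMap.injective_iff_surjective_of_finrank_eq_finrank ?_).1 hinj⟩
  rw [hC.1, Module.finrank_linearMap, hY, Module.finrank_fin_fun, mul_comm]

end

/-- Each `(k-δ+1)`-dimensional subspace of `F^n` all of whose nonzero vectors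
belong to `L^{(n,k)}` is contained in exactly one codeword of the lifted MRD code. -/
theorem stmt3 (q n k δ : ℕ) (hq : Fintype.card F = q)
    (hk : 1 < k) (hkn : k ≤ n - k) (hδ1 : 1 ≤ δ) (hδk : δ ≤ k)
    (C : Submodule F (Matrix (Fin k) (Fin (n - k)) F)) (hC : IsMRD F n k δ C) :
    ∀ Y : Submodule F (Fin n → F), finrank F Y = k - δ + 1 →
      (∀ v : Fin n → F, v ∈ Y → v ≠ 0 → v ∈ Lset F n k) →
      ∃! X : Submodule F (Fin n → F), X ∈ liftedCode F n k C ∧ Y ≤ X := by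
  intro Y hY hL
  have h : k ≤ n := by omega
  have hf : Function.Injective ((headMap h).domRestrict Y) := by
    rw [injective_iff_map_eq_zero]
    rintro ⟨v, hv⟩ h0
    by_contra hne
    obtain ⟨i, hi, hvi⟩ := hL v hv (by simpa using hne)
    exact hvi (congrFun h0 ⟨i, hi⟩)
  have hbij := hC.bijective_vecMulHom hδk hY hf
  have hiff (A : C) : Y ≤ liftSubspace F n k A ↔
      (vecMulHom ((headMap h).domRestrict Y)).domRestrict C A =
        (tailMap n k).domRestrict Y := by
    rw [LinearMap.ext_iff, Subtype.forall]
    exact forall₂_congr fun v _ => mem_liftSubspace_iff h (A : Matrix (Fin k) (Fin (n - k)) F) v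
  obtain ⟨A, hA, huniq⟩ := hbij.existsUnique ((tailMap n k).domRestrict Y)
  refine ⟨liftSubspace F n k A, ⟨⟨A, A.2, rfl⟩, (hiff A).2 hA⟩, ?_⟩
  rintro _ ⟨⟨B, hB, rfl⟩, hYB⟩
  rw [← huniq ⟨B, hB⟩ ((hiff ⟨B, hB⟩).1 hYB)]
end

section
/- Let q be a prime power and let n, k, δ be integers with 1 ≤ δ ≤ k ≤ n. Every (n,M,2δ,k)_q constant dimension code satisfies M ≤ Gauss[n, k−δ+1]_q / Gauss[k, k−δ+1]_q; equivalently, M · ∏_{i=0}^{k−δ} (q^{k−i} − 1) ≤ ∏_{i=0}^{k−δ} (q^{n−i} − 1). In particular A_q(n,2δ,k) ≤ Gauss[n, k−δ+1]_q / Gauss[k, k−δ+1]_q. -/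
open Module Polynomial Matrix

variable (F : Type) [Field F] [Fintype F]

omit [Fintype F] in
/-- A linearly independent family in a subspace `Z` has at most `finrank Z` members. -/
theorem le_finrank_of_linearIndependent_of_mem {V : Type*} [AddCommGroup V] [Module F V]
    [FiniteDimensional F V] {r : ℕ} {v : Fin r → V} (hv : LinearIndependent F v)
    (Z : Submodule F V) (hZ : ∀ i, v i ∈ Z) : r ≤ finrank F Z := by
  have hw : LinearIndependent F (fun i => (⟨v i, hZ i⟩ : Z)) :=
    LinearIndependent.of_comp Z.subtype hv
  simpa using hw.fintype_card_le_finrank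

/-- If distinct members of a family of `k`-dimensional subspaces of `V` meet in dimension less
than `r`, then counting linearly independent `r`-tuples bounds the size of the family. -/
theorem ncard_mul_prod_le_of_finrank_inf_lt {V : Type*} [AddCommGroup V] [Module F V]
    [FiniteDimensional F V] {k r : ℕ} (hrk : r ≤ k) (hrn : r ≤ finrank F V)
    (S : Set (Submodule F V)) (hdim : ∀ X ∈ S, finrank F X = k)
    (hinf : ∀ X ∈ S, ∀ Y ∈ S, X ≠ Y → finrank F (X ⊓ Y : Submodule F V) < r) :
    S.ncard * ∏ i : Fin r, (Fintype.card F ^ k - Fintype.card F ^ (i : ℕ)) ≤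
      ∏ i : Fin r, (Fintype.card F ^ finrank F V - Fintype.card F ^ (i : ℕ)) := by
  have : Finite V := Module.finite_of_finite F
  have : Finite (Submodule F V) := Finite.of_injective _ SetLike.coe_injective
  have : Fintype S := Fintype.ofFinite S
  have hX : ∀ X : S, Nat.card {s : Fin r → X.1 // LinearIndependent F s} =
      ∏ i : Fin r, (Fintype.card F ^ k - Fintype.card F ^ (i : ℕ)) := fun X => by
    have hXk := hdim X.1 X.2
    rw [card_linearIndependent (hrk.trans_eq hXk.symm), hXk]
  rw [← card_linearIndependent hrn]
  have hcard : Nat.card (Σ X : S, {s : Fin r → X.1 // LinearIndependent F s}) =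
      S.ncard * ∏ i : Fin r, (Fintype.card F ^ k - Fintype.card F ^ (i : ℕ)) := by
    rw [Nat.card_sigma, Finset.sum_congr rfl fun X _ => hX X, Finset.sum_const, smul_eq_mul,
      Finset.card_univ, ← Nat.card_eq_fintype_card, Nat.card_coe_set_eq]
  rw [← hcard]
  refine Nat.card_le_card_of_injective
    (fun p => ⟨fun i => (p.2.1 i : V), p.2.2.map' p.1.1.subtype (Submodule.ker_subtype _)⟩) ?_
  rintro ⟨⟨X, hXS⟩, s, hs⟩ ⟨⟨Y, hYS⟩, t, ht⟩ h
  have hst : ∀ i, (s i : V) = t i := fun i => congrFun (congrArg Subtype.val h) i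
  have hXY : X = Y := by
    by_contra hne
    refine (hinf X hXS Y hYS hne).not_ge (le_finrank_of_linearIndependent_of_mem F
      (hs.map' X.subtype (Submodule.ker_subtype _)) _ fun i => ⟨(s i).2, ?_⟩)
    change (s i : V) ∈ Y
    exact hst i ▸ (t i).2
  subst hXY
  obtain rfl : s = t := funext fun i => Subtype.ext (hst i)
  rfl

theorem prod_pow_sub_pow_eq (q m r : ℕ) (hrm : r ≤ m) :
    ∏ i : Fin r, (q ^ m - q ^ (i : ℕ)) =
      (∏ i ∈ Finset.range r, q ^ i) * ∏ i ∈ Finset.range r, (q ^ (m - i) - 1) := by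
  rw [Fin.prod_univ_eq_prod_range (fun i => q ^ m - q ^ i), ← Finset.prod_mul_distrib]
  refine Finset.prod_congr rfl fun i hi => ?_
  have him : i ≤ m := (Finset.mem_range.mp hi).le.trans hrm
  rw [Nat.mul_sub, mul_one, ← pow_add, Nat.add_sub_cancel' him]

/-- The anticode bound for a single constant dimension code. -/
theorem ncard_mul_prod_le_of_subDist (n k δ : ℕ) (hδ1 : 1 ≤ δ) (hδk : δ ≤ k) (hkn : k ≤ n)
    (S : Set (Submodule F (Fin n → F))) (hdim : ∀ X ∈ S, finrank F X = k)
    (hdist : ∀ X ∈ S, ∀ Y ∈ S, X ≠ Y → 2 * δ ≤ subDist F X Y) :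
    S.ncard * ∏ i ∈ Finset.range (k - δ + 1), (Fintype.card F ^ (k - i) - 1) ≤
      ∏ i ∈ Finset.range (k - δ + 1), (Fintype.card F ^ (n - i) - 1) := by
  have hbound := ncard_mul_prod_le_of_finrank_inf_lt F (k := k) (r := k - δ + 1) (by omega)
    (by rw [finrank_fin_fun]; omega) S hdim fun X hX Y hY hne => by
      have h := hdist X hX Y hY hne
      rw [subDist, hdim X hX, hdim Y hY] at h
      omega
  rw [finrank_fin_fun, prod_pow_sub_pow_eq _ k _ (by omega),
    prod_pow_sub_pow_eq _ n _ (by omega), mul_left_comm] at hbound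
  exact Nat.le_of_mul_le_mul_left hbound
    (Finset.prod_pos fun i _ => pow_pos Fintype.card_pos i)

/-- (Johnson-type / anticode bound.) Every `(n, M, 2δ, k)_q` constant dimension
code satisfies `M · ∏_{i=0}^{k-δ} (q^{k-i} - 1) ≤ ∏_{i=0}^{k-δ} (q^{n-i} - 1)` (the product form
of `M ≤ Gauss[n, k-δ+1]_q / Gauss[k, k-δ+1]_q`); in particular this bounds `A_q(n, 2δ, k)`. -/
theorem stmt8 (q n k δ : ℕ) (hq : Fintype.card F = q)
    (hδ1 : 1 ≤ δ) (hδk : δ ≤ k) (hkn : k ≤ n)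
    (S : Set (Submodule F (Fin n → F))) (hfin : S.Finite)
    (hdim : ∀ X ∈ S, finrank F X = k)
    (hdist : ∀ X ∈ S, ∀ Y ∈ S, X ≠ Y → 2 * δ ≤ subDist F X Y) :
    S.ncard * ∏ i ∈ Finset.range (k - δ + 1), (q ^ (k - i) - 1) ≤
      ∏ i ∈ Finset.range (k - δ + 1), (q ^ (n - i) - 1) ∧
    Aq F n (2 * δ) k * ∏ i ∈ Finset.range (k - δ + 1), (q ^ (k - i) - 1) ≤
      ∏ i ∈ Finset.range (k - δ + 1), (q ^ (n - i) - 1) := by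
  subst hq
  have hcode := ncard_mul_prod_le_of_subDist F n k δ hδ1 hδk hkn
  refine ⟨hcode S hdim hdist, ?_⟩
  have : Finite (Submodule F (Fin n → F)) := Finite.of_injective _ SetLike.coe_injective
  obtain ⟨T, -, hT, hTdim, hTdist⟩ : Aq F n (2 * δ) k ∈ {M | ∃ S : Set (Submodule F (Fin n → F)),
      S.Finite ∧ S.ncard = M ∧ (∀ X ∈ S, finrank F X = k) ∧
      ∀ X ∈ S, ∀ Y ∈ S, X ≠ Y → 2 * δ ≤ subDist F X Y} := by
    refine Nat.sSup_mem ⟨S.ncard, S, hfin, rfl, hdim, hdist⟩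
      ⟨Nat.card (Submodule F (Fin n → F)), ?_⟩
    rintro _ ⟨T, -, rfl, -⟩
    exact Set.ncard_le_card T
  exact hT ▸ hcode T hTdim hTdist
end

section
/- Let q ≥ 2 be a real number (in particular any prime power) and let n, k, δ be integers with 1 ≤ δ ≤ k ≤ n−k. Then Gauss[n, k−δ+1]_q / Gauss[k, k−δ+1]_q < q^{(n−k)(k−δ+1)} / ∏_{j=δ}^{∞} (1 − q^{−j}); equivalently, the ratio of q^{(n−k)(k−δ+1)} (the size of an (n,k,δ)_q lifted MRD code) to the upper bound Gauss[n, k−δ+1]_q / Gauss[k, k−δ+1]_q is strictly greater than Q_δ(q) = ∏_{j=δ}^{∞} (1 − q^{−j}). -/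
/-- The Gaussian coefficient `[n, k]_q` as a real number:
`∏_{i=0}^{k-1} (q^{n-i} - 1)/(q^{k-i} - 1)`. -/
noncomputable def gaussR (q : ℝ) (n k : ℕ) : ℝ :=
  ∏ i ∈ Finset.range k, (q ^ (n - i) - 1) / (q ^ (k - i) - 1)

/-- If `0 ≤ x j < 1` and `x` is summable, then `∏' j, (1 - x j)` is positive and at most each of
its partial products. -/
theorem tprod_one_sub_pos_and_le_prod {x : ℕ → ℝ} (h0 : ∀ j, 0 ≤ x j) (h1 : ∀ j, x j < 1)
    (hx : Summable x) :
    0 < ∏' j, (1 - x j) ∧ ∀ m, ∏' j, (1 - x j) ≤ ∏ j ∈ Finset.range m, (1 - x j) := by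
  have hpos : ∀ j, 0 < 1 - x j := fun j => sub_pos.2 (h1 j)
  have hlog : Summable fun j => Real.log (1 - x j) := by
    simpa only [sub_eq_add_neg] using Real.summable_log_one_add_of_summable hx.neg
  refine ⟨by rw [← Real.rexp_tsum_eq_tprod hpos hlog]; exact Real.exp_pos _, fun m => ?_⟩
  have hanti : Antitone fun m => ∏ j ∈ Finset.range m, (1 - x j) := by
    refine antitone_nat_of_succ_le fun m => ?_
    rw [Finset.prod_range_succ]
    exact mul_le_of_le_one_right (Finset.prod_nonneg fun j _ => (hpos j).le)
      (sub_le_self _ (h0 m))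
  exact hanti.le_of_tendsto
    (Real.multipliable_of_summable_log hpos hlog).hasProd.tendsto_prod_nat m

theorem gaussR_pos {q : ℝ} (hq : 1 < q) {n k : ℕ} (hkn : k ≤ n) : 0 < gaussR q n k := by
  refine Finset.prod_pos fun i hi => ?_
  have hi := Finset.mem_range.1 hi
  exact div_pos (sub_pos.2 (one_lt_pow₀ hq (by omega))) (sub_pos.2 (one_lt_pow₀ hq (by omega)))

theorem gaussR_div_gaussR {q : ℝ} (hq : 1 < q) (n k : ℕ) {m : ℕ} :
    gaussR q n m / gaussR q k m =
      ∏ i ∈ Finset.range m, (q ^ (n - i) - 1) / (q ^ (k - i) - 1) := by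
  rw [gaussR, gaussR, ← Finset.prod_div_distrib]
  refine Finset.prod_congr rfl fun i hi => ?_
  have hi := Finset.mem_range.1 hi
  exact div_div_div_cancel_right₀ (sub_pos.2 (one_lt_pow₀ hq (by omega))).ne' _ _

/-- The ratio of Gaussian coefficients times `∏_{j=k-m+1}^{k} (1 - q^{-j})` is less than
`q^{(n-k)m}`. -/
theorem gaussR_div_gaussR_mul_prod_lt {q : ℝ} (hq : 1 < q) {n k m : ℕ} (hm : m ≠ 0)
    (hmk : m ≤ k) (hkn : k ≤ n) :
    gaussR q n m / gaussR q k m * ∏ j ∈ Finset.range m, (1 - q⁻¹ ^ (k - m + 1 + j)) <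
      q ^ ((n - k) * m) := by
  have hq0 : 0 < q := by positivity
  rw [gaussR_div_gaussR hq, ← Finset.prod_range_reflect (fun j => 1 - q⁻¹ ^ (k - m + 1 + j)),
    ← Finset.prod_mul_distrib, pow_mul]
  have hconst : (q ^ (n - k)) ^ m = ∏ _i ∈ Finset.range m, q ^ (n - k) := by simp
  have hfactor : ∀ i ∈ Finset.range m,
      (q ^ (n - i) - 1) / (q ^ (k - i) - 1) * (1 - q⁻¹ ^ (k - m + 1 + (m - 1 - i))) =
        (q ^ (n - i) - 1) / q ^ (k - i) := by
    intro i hi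
    have hi := Finset.mem_range.1 hi
    have hne : q ^ (k - i) - 1 ≠ 0 := (sub_pos.2 (one_lt_pow₀ hq (by omega))).ne'
    rw [show k - m + 1 + (m - 1 - i) = k - i by omega, inv_pow]
    field_simp
  rw [Finset.prod_congr rfl hfactor, hconst]
  refine Finset.prod_lt_prod_of_nonempty (fun i hi => ?_) (fun i hi => ?_)
    (Finset.nonempty_range_iff.2 hm)
  all_goals have hi := Finset.mem_range.1 hi
  · exact div_pos (sub_pos.2 (one_lt_pow₀ hq (by omega))) (by positivity)
  · rw [div_lt_iff₀ (by positivity), ← pow_add, show n - k + (k - i) = n - i by omega]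
    exact sub_one_lt _

/-- For every real `q ≥ 2` and integers `1 ≤ δ ≤ k ≤ n-k`, the Johnson-type
bound `Gauss[n, k-δ+1]_q / Gauss[k, k-δ+1]_q` is less than
`q^{(n-k)(k-δ+1)} / Q_δ(q)` where `Q_δ(q) = ∏_{j=δ}^{∞} (1 - q^{-j})`; equivalently, the ratio
of `q^{(n-k)(k-δ+1)}` (the size of an `(n,k,δ)_q` lifted MRD code) to this bound is strictly
greater than `Q_δ(q)`. -/
theorem stmt9 (q : ℝ) (hq : 2 ≤ q) (n k δ : ℕ) (hδ1 : 1 ≤ δ) (hδk : δ ≤ k) (hkn : k ≤ n - k) :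
    gaussR q n (k - δ + 1) / gaussR q k (k - δ + 1) <
      q ^ ((n - k) * (k - δ + 1)) / ∏' j : ℕ, (1 - q⁻¹ ^ (δ + j)) ∧
    (∏' j : ℕ, (1 - q⁻¹ ^ (δ + j))) <
      q ^ ((n - k) * (k - δ + 1)) /
        (gaussR q n (k - δ + 1) / gaussR q k (k - δ + 1)) := by
  have hq1 : 1 < q := by linarith
  have hinv0 : 0 ≤ q⁻¹ := by positivity
  have hinv1 : q⁻¹ < 1 := inv_lt_one_of_one_lt₀ hq1
  have hsum : Summable fun j : ℕ => q⁻¹ ^ (δ + j) := by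
    simpa only [pow_add] using (summable_geometric_of_lt_one hinv0 hinv1).mul_left (q⁻¹ ^ δ)
  obtain ⟨hQpos, hQle⟩ := tprod_one_sub_pos_and_le_prod (fun j => pow_nonneg hinv0 (δ + j))
    (fun j => pow_lt_one₀ hinv0 hinv1 (by omega)) hsum
  have hratio : 0 < gaussR q n (k - δ + 1) / gaussR q k (k - δ + 1) :=
    div_pos (gaussR_pos hq1 (by omega)) (gaussR_pos hq1 (by omega))
  have hlt := gaussR_div_gaussR_mul_prod_lt hq1 (n := n) (k := k) (m := k - δ + 1)
    (by omega) (by omega) (by omega)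
  rw [show k - (k - δ + 1) + 1 = δ by omega] at hlt
  have hmain := (mul_le_mul_of_nonneg_left (hQle (k - δ + 1)) hratio.le).trans_lt hlt
  exact ⟨(lt_div_iff₀ hQpos).2 hmain, (lt_div_iff₀ hratio).2 (by rwa [mul_comm])⟩
end

section
/- Let q be a prime power and let n, k be integers with 3 ≤ k ≤ n−k. If ℂ is an (n,M,2(k−1),k)_q constant dimension code which contains an (n,k,k−1)_q lifted MRD code C^MRD as a subcode, then M ≤ q^{2(n−k)} + A_q(n−k, 2(k−2), k−1). -/
open Module Polynomial Matrix

variable (F : Type) [Field F] [Fintype F]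

section

set_option linter.unusedSectionVars false

variable {F}

/-- The projection of `F^n` onto its last `n - k` coordinates. -/
def projTail (n k : ℕ) (v : Fin n → F) : Fin (n - k) → F :=
  fun j => v ⟨k + j, by have := j.isLt; omega⟩

/-- `projK` as a linear map. -/
def projKLin (n k : ℕ) : (Fin n → F) →ₗ[F] (Fin k → F) where
  toFun := projK F n k
  map_add' u v := by
    ext i
    by_cases h : (i : ℕ) < n <;> simp [projK, h]
  map_smul' c v := by
    ext i
    by_cases h : (i : ℕ) < n <;> simp [projK, h]

/-- The embedding of `F^(n-k)` into `F^n` that prepends `k` zeros. -/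
def embedTail (n k : ℕ) : (Fin (n - k) → F) →ₗ[F] (Fin n → F) where
  toFun w j := if h : (j : ℕ) < k then 0 else w ⟨(j : ℕ) - k, by have := j.isLt; omega⟩
  map_add' u v := by
    ext j
    by_cases h : (j : ℕ) < k <;> simp [h]
  map_smul' c v := by
    ext j
    by_cases h : (j : ℕ) < k <;> simp [h]

theorem projTail_embedTail (n k : ℕ) (w : Fin (n - k) → F) :
    projTail n k (embedTail n k w) = w := by
  ext j
  simp [projTail, embedTail]

theorem embedTail_injective (n k : ℕ) :
    Function.Injective (embedTail n k : (Fin (n - k) → F) →ₗ[F] (Fin n → F)) :=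
  Function.LeftInverse.injective (projTail_embedTail n k)

theorem ker_projKLin_le_range_embedTail (n k : ℕ) :
    LinearMap.ker (projKLin n k : (Fin n → F) →ₗ[F] (Fin k → F)) ≤
      LinearMap.range (embedTail n k) := by
  intro v hv
  refine ⟨projTail n k v, ?_⟩
  ext j
  by_cases h : (j : ℕ) < k
  · have hj := congrFun (LinearMap.mem_ker.mp hv) ⟨j, h⟩
    simp only [projKLin, LinearMap.coe_mk, AddHom.coe_mk, projK, j.isLt, dite_true, Fin.eta,
      Pi.zero_apply] at hj
    simp [embedTail, h, hj]
  · have hj : k + ((j : ℕ) - k) = j := by omega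
    simp [embedTail, projTail, h, hj]

/-- The dimension of `X` is at most that of its part supported on the last `n - k` coordinates
plus that of its projection onto the first `k` coordinates. -/
theorem finrank_le_finrank_comap_embedTail_add (n k : ℕ) (X : Submodule F (Fin n → F)) :
    finrank F X ≤
      finrank F (X.comap (embedTail n k)) + finrank F (X.map (projKLin n k)) := by
  have hrn := ((projKLin n k : (Fin n → F) →ₗ[F] (Fin k → F)).domRestrict X)
    |>.finrank_range_add_finrank_ker
  rw [LinearMap.range_domRestrict] at hrn
  have hker : (LinearMap.ker ((projKLin n k : (Fin n → F) →ₗ[F] (Fin k → F)).domRestrict X)).map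
      X.subtype ≤ (X.comap (embedTail n k)).map (embedTail n k) := by
    rintro _ ⟨v, hv, rfl⟩
    obtain ⟨w, hw⟩ := ker_projKLin_le_range_embedTail n k (x := (v : Fin n → F))
      (by simpa using hv)
    exact ⟨w, by simp [hw], hw⟩
  have hle := (Submodule.finrank_mono hker).trans (Submodule.finrank_map_le _ _)
  rw [Submodule.finrank_map_subtype_eq] at hle
  omega

theorem mem_liftSubspace {n k : ℕ} (hkn : k ≤ n) (A : Matrix (Fin k) (Fin (n - k)) F)
    (v : Fin n → F) (hv : projK F n k v ᵥ* A = projTail n k v) : v ∈ liftSubspace F n k A := by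
  have hsum : v = ∑ i, projK F n k v i • liftMatrix F n k A i := by
    ext j
    by_cases h : (j : ℕ) < k
    · rw [Finset.sum_apply, Finset.sum_eq_single ⟨j, h⟩]
      · simp [liftMatrix, projK, h]
      · intro i _ hi
        have : (i : ℕ) ≠ j := fun h' => hi (Fin.ext h')
        simp [liftMatrix, h, this]
      · simp
    · have hj := congrFun hv ⟨(j : ℕ) - k, by have := j.isLt; omega⟩
      have hjk : k + ((j : ℕ) - k) = j := by omega
      simp only [projTail, hjk, Fin.eta] at hj
      rw [← hj]
      simp [liftMatrix, h, vecMul, dotProduct]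
  rw [hsum]
  exact Submodule.sum_mem _ fun i _ =>
    Submodule.smul_mem _ _ (Submodule.subset_span (Set.mem_range_self i))

/-- An MRD code contains, for each `B` of full row rank `k - δ + 1`, a solution `A` of
`B * A = D`. -/
theorem IsMRD.exists_mul_eq {n k δ : ℕ} {C : Submodule F (Matrix (Fin k) (Fin (n - k)) F)}
    (hC : IsMRD F n k δ C) (hδk : δ ≤ k)
    (B : Matrix (Fin (k - δ + 1)) (Fin k) F) (hB : LinearIndependent F B.row)
    (D : Matrix (Fin (k - δ + 1)) (Fin (n - k)) F) : ∃ A ∈ C, B * A = D := by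
  let f : C →ₗ[F] Matrix (Fin (k - δ + 1)) (Fin (n - k)) F :=
    { toFun := fun A => B * (A : Matrix (Fin k) (Fin (n - k)) F)
      map_add' := fun _ _ => Matrix.mul_add _ _ _
      map_smul' := fun _ _ => Matrix.mul_smul _ _ _ }
  have hinj : Function.Injective f := by
    rw [← LinearMap.ker_eq_bot, LinearMap.ker_eq_bot']
    intro A hA
    by_contra hA0
    have hrank := hC.2 A A.2 (by simpa using hA0)
    have hadd := rank_add_rank_le_card_of_mul_eq_zero (A := B)
      (B := (A : Matrix (Fin k) (Fin (n - k)) F)) hA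
    rw [hB.rank_matrix] at hadd
    simp only [Fintype.card_fin] at hadd
    omega
  have hfin : finrank F C = finrank F (Matrix (Fin (k - δ + 1)) (Fin (n - k)) F) := by
    rw [hC.1, Module.finrank_matrix]
    simp [mul_comm]
  obtain ⟨A, hA⟩ :=
    (LinearMap.injective_iff_surjective_of_finrank_eq_finrank hfin).mp hinj D
  exact ⟨A, A.2, hA⟩

/-- If the projection of `X` has dimension more than `k - δ`, then `X` shares a subspace of
dimension more than `k - δ` with some codeword of the lifted MRD code. -/
theorem IsMRD.exists_finrank_inf_liftSubspace {n k δ : ℕ}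
    {C : Submodule F (Matrix (Fin k) (Fin (n - k)) F)}
    (hC : IsMRD F n k δ C) (hδk : δ ≤ k) (hkn : k ≤ n)
    (X : Submodule F (Fin n → F)) (hX : k - δ < finrank F (X.map (projKLin n k))) :
    ∃ A ∈ C, k - δ < finrank F (X ⊓ liftSubspace F n k A : Submodule F (Fin n → F)) := by
  obtain ⟨b, hb⟩ := exists_linearIndependent_of_le_finrank (Nat.succ_le_of_lt hX)
  choose u huX hu using fun i => (b i).2
  have hb' : LinearIndependent F fun i => projKLin n k (u i) := by
    have : (fun i => projKLin n k (u i)) = fun i => ((b i : Fin k → F)) := funext hu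
    rw [this]
    exact hb.map' _ (Submodule.ker_subtype _)
  obtain ⟨A, hA, hBA⟩ := hC.exists_mul_eq hδk (Matrix.of fun i => projK F n k (u i)) hb'
    (Matrix.of fun i => projTail n k (u i))
  refine ⟨A, hA, ?_⟩
  have hmem (i) : u i ∈ X ⊓ liftSubspace F n k A :=
    ⟨huX i, mem_liftSubspace hkn A _ (congrFun hBA i)⟩
  have hu' : LinearIndependent F u := hb'.of_comp (projKLin n k)
  have hcard := (LinearIndependent.of_comp (X ⊓ liftSubspace F n k A).subtype
    (v := fun i => (⟨u i, hmem i⟩ : (X ⊓ liftSubspace F n k A : Submodule F (Fin n → F))))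
    hu').fintype_card_le_finrank
  rw [Fintype.card_fin] at hcard
  omega

theorem ncard_liftedCode_le (n k : ℕ) (C : Submodule F (Matrix (Fin k) (Fin (n - k)) F)) :
    (liftedCode F n k C).ncard ≤ Fintype.card F ^ finrank F C := by
  have himage : liftedCode F n k C = liftSubspace F n k '' C := by
    ext X
    simp [liftedCode, eq_comm]
  rw [himage]
  refine (Set.ncard_image_le (Set.toFinite _)).trans_eq ?_
  rw [← Nat.card_coe_set_eq, ← Nat.card_eq_fintype_card]
  exact Module.natCard_eq_pow_finrank (K := F) (V := C)

theorem ncard_le_Aq {n d k : ℕ} (S : Set (Submodule F (Fin n → F)))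
    (hdim : ∀ X ∈ S, finrank F X = k)
    (hdist : ∀ X ∈ S, ∀ Y ∈ S, X ≠ Y → d ≤ subDist F X Y) : S.ncard ≤ Aq F n d k := by
  have : Finite (Submodule F (Fin n → F)) :=
    Finite.of_injective (fun X => (X : Set (Fin n → F))) SetLike.coe_injective
  refine le_csSup ⟨Nat.card (Submodule F (Fin n → F)), ?_⟩
    ⟨S, S.toFinite, rfl, hdim, hdist⟩
  rintro _ ⟨T, -, rfl, -⟩
  exact Set.ncard_le_card T

/-- Codewords meeting the last `n - k` coordinates in dimension at least `r`, and each other in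
dimension at most `t < r`, yield a code in `F^(n-k)`. -/
theorem ncard_le_Aq_of_comap_embedTail {n k r t : ℕ} (htr : t < r)
    (S : Set (Submodule F (Fin n → F)))
    (hr : ∀ X ∈ S, r ≤ finrank F (X.comap (embedTail n k)))
    (ht : ∀ X ∈ S, ∀ Y ∈ S, X ≠ Y → finrank F (X ⊓ Y : Submodule F (Fin n → F)) ≤ t) :
    S.ncard ≤ Aq F (n - k) (2 * (r - t)) r := by
  have hsub (X : Submodule F (Fin n → F)) : ∃ T : Submodule F (Fin (n - k) → F),
      X ∈ S → T ≤ X.comap (embedTail n k) ∧ finrank F T = r := by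
    by_cases hX : X ∈ S
    · obtain ⟨b, hb⟩ := exists_linearIndependent_of_le_finrank (hr X hX)
      refine ⟨Submodule.span F (Set.range fun i => (b i : Fin (n - k) → F)),
        fun _ => ⟨Submodule.span_le.mpr ?_, ?_⟩⟩
      · rintro _ ⟨i, rfl⟩
        exact (b i).2
      · have hb' := hb.map' _ (X.comap (embedTail n k)).ker_subtype
        exact (finrank_span_eq_card hb').trans (Fintype.card_fin r)
    · exact ⟨⊥, fun h => (hX h).elim⟩
  choose g hg using hsub
  have hinf : ∀ X ∈ S, ∀ Y ∈ S, X ≠ Y →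
      finrank F (g X ⊓ g Y : Submodule F (Fin (n - k) → F)) ≤ t := by
    intro X hX Y hY hXY
    refine le_trans ?_ (ht X hX Y hY hXY)
    rw [(Submodule.equivMapOfInjective _ (embedTail_injective n k) (g X ⊓ g Y)).finrank_eq]
    refine Submodule.finrank_mono (Submodule.map_le_iff_le_comap.mpr ?_)
    exact inf_le_inf (hg X hX).1 (hg Y hY).1
  have hinj : Set.InjOn g S := by
    intro X hX Y hY hXY
    by_contra hne
    have h := hinf X hX Y hY hne
    rw [hXY, inf_idem, (hg Y hY).2] at h
    omega
  rw [← hinj.ncard_image]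
  refine ncard_le_Aq _ ?_ ?_
  · rintro _ ⟨X, hX, rfl⟩
    exact (hg X hX).2
  · rintro _ ⟨X, hX, rfl⟩ _ ⟨Y, hY, rfl⟩ hne
    have h := hinf X hX Y hY fun h => hne (congrArg g h)
    rw [subDist, (hg X hX).2, (hg Y hY).2]
    omega

end

/-- If an `(n, M, 2(k-1), k)_q` constant dimension code contains an
`(n,k,k-1)_q` lifted MRD code, then `M ≤ q^{2(n-k)} + A_q(n-k, 2(k-2), k-1)`. -/
theorem stmt10 (q n k : ℕ) (hq : Fintype.card F = q) (hk : 3 ≤ k) (hkn : k ≤ n - k)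
    (C : Submodule F (Matrix (Fin k) (Fin (n - k)) F)) (hC : IsMRD F n k (k - 1) C)
    (S : Set (Submodule F (Fin n → F))) (hfin : S.Finite)
    (hsub : liftedCode F n k C ⊆ S)
    (hdim : ∀ X ∈ S, finrank F X = k)
    (hdist : ∀ X ∈ S, ∀ Y ∈ S, X ≠ Y → 2 * (k - 1) ≤ subDist F X Y) :
    S.ncard ≤ q ^ (2 * (n - k)) + Aq F (n - k) (2 * (k - 2)) (k - 1) := by
  have hinf : ∀ X ∈ S, ∀ Y ∈ S, X ≠ Y → finrank F (X ⊓ Y : Submodule F (Fin n → F)) ≤ 1 := by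
    intro X hX Y hY hXY
    have h := hdist X hX Y hY hXY
    rw [subDist, hdim X hX, hdim Y hY] at h
    omega
  have hδ : k - (k - 1) = 1 := by omega
  have hlift : (liftedCode F n k C).ncard ≤ q ^ (2 * (n - k)) := by
    refine (ncard_liftedCode_le n k C).trans_eq ?_
    rw [hC.1, hq, hδ, mul_comm]
  have hrest : (S \ liftedCode F n k C).ncard ≤ Aq F (n - k) (2 * (k - 2)) (k - 1) := by
    have hd : k - 2 = k - 1 - 1 := by omega
    rw [hd]
    refine ncard_le_Aq_of_comap_embedTail (by omega) _ ?_
      fun X hX Y hY hXY => hinf X hX.1 Y hY.1 hXY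
    rintro X ⟨hX, hXC⟩
    by_contra hlt
    have hle := finrank_le_finrank_comap_embedTail_add n k X
    rw [hdim X hX] at hle
    obtain ⟨A, hA, hAX⟩ :=
      hC.exists_finrank_inf_liftSubspace (by omega) (by omega) X (by omega)
    have hmem : liftSubspace F n k A ∈ liftedCode F n k C := ⟨A, hA, rfl⟩
    have := hinf X hX _ (hsub hmem) fun h => hXC (h ▸ hmem)
    omega
  have hcard := Set.ncard_sdiff_add_ncard_of_subset hsub hfin
  omega
end
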